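/- arXiv:1709.06826 — 12 statements merged into one kernel-verified Lean document; each statement's English description precedes it below -/
import Mathlib

section
/- The ternary algebra 𝒱_{0,0,h} (f = 0, g = 0, h the standard form) is a ternary Jordan algebra if and only if char F = 3 and n = 1. -/
/-- Total commutativity of a ternary product: invariance under all permutations
of the three arguments. -/
def TotComm {W : Type*} (p : W → W → W → W) : Prop :=
  ∀ (σ : Equiv.Perm (Fin 3)) (v : Fin 3 → W),
    p (v (σ 0)) (v (σ 1)) (v (σ 2)) = p (v 0) (v 1) (v 2)

/-- The operator `D_{x,y} = [R_{(x₂,x₃)}, R_{(y₂,y₃)}]`,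
i.e. `z ↦ ⟦⟦z,x₂,x₃⟧,y₂,y₃⟧ − ⟦⟦z,y₂,y₃⟧,x₂,x₃⟧`. -/
def Dop {W : Type*} [Sub W] (p : W → W → W → W) (x₂ x₃ y₂ y₃ z : W) : W :=
  p (p z x₂ x₃) y₂ y₃ - p (p z y₂ y₃) x₂ x₃

/-- A map `D` is a derivation of the ternary product `p`. -/
def IsTernaryDer {W : Type*} [Add W] (p : W → W → W → W) (D : W → W) : Prop :=
  ∀ a b c, D (p a b c) = p (D a) b c + p a (D b) c + p a b (D c)

/-- A ternary algebra is a ternary Jordan algebra if its product is totally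
commutative and every operator `D_{x,y}` is a derivation. -/
def IsTernaryJordan {W : Type*} [Add W] [Sub W] (p : W → W → W → W) : Prop :=
  TotComm p ∧ ∀ x₂ x₃ y₂ y₃, IsTernaryDer p (Dop p x₂ x₃ y₂ y₃)

/-- The product of the ternary algebra `𝒱_{0,0,h}` on `F × Fⁿ`, where
`h(u,v) = ∑ᵢ uᵢvᵢ` is the standard bilinear form and `f = 0`, `g = 0`. -/
def V00h (F : Type*) [Field F] (n : ℕ) :
    (F × (Fin n → F)) → (F × (Fin n → F)) → (F × (Fin n → F)) → (F × (Fin n → F)) :=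
  fun x y z =>
    (x.1 * y.1 * z.1,
      (y.1 * z.1 + ∑ i, y.2 i * z.2 i) • x.2 +
      (x.1 * z.1 + ∑ i, x.2 i * z.2 i) • y.2 +
      (x.1 * y.1 + ∑ i, x.2 i * y.2 i) • z.2)

theorem totComm_V00h (F : Type*) [Field F] (n : ℕ) : TotComm (V00h F n) := by
  have swap₁₂ : ∀ x y z, V00h F n x y z = V00h F n y x z := by
    intro x y z
    simp only [V00h, mul_comm (x.2 _) (y.2 _), mul_comm x.1 y.1,
      add_comm ((y.1 * z.1 + ∑ i, y.2 i * z.2 i) • x.2)]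
  have swap₂₃ : ∀ x y z, V00h F n x y z = V00h F n x z y := by
    intro x y z
    simp only [V00h, mul_comm (y.2 _) (z.2 _), mul_comm y.1 z.1, mul_right_comm x.1 y.1 z.1,
      add_right_comm _ ((x.1 * z.1 + ∑ i, x.2 i * z.2 i) • y.2)]
  intro σ v
  have h₀₁ : σ 0 ≠ σ 1 := by simp
  have h₀₂ : σ 0 ≠ σ 2 := by simp
  have h₁₂ : σ 1 ≠ σ 2 := by simp
  generalize σ 0 = i at *
  generalize σ 1 = j at *
  generalize σ 2 = k at *
  fin_cases i <;> fin_cases j <;> fin_cases k <;> simp at h₀₁ h₀₂ h₁₂ ⊢ <;> grind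

/-- If `3 = 0` and `n = 1`, the product is that of three dual numbers, so right multiplications
commute. -/
theorem Dop_V00h_one (F : Type*) [Field F] (h3 : (3 : F) = 0) (x₂ x₃ y₂ y₃ z) :
    Dop (V00h F 1) x₂ x₃ y₂ y₃ z = 0 := by
  ext i
  · simp only [Dop, V00h, Prod.fst_sub, Prod.fst_zero]
    ring
  · fin_cases i
    simp only [Dop, V00h, Finset.univ_unique, Fin.default_eq_zero, Finset.sum_singleton,
      Prod.snd_sub, Prod.snd_zero, Pi.sub_apply, Pi.add_apply, Pi.smul_apply, smul_eq_mul,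
      Pi.zero_apply, Fin.zero_eta, Fin.isValue]
    grind

theorem nine_eq_zero_of_isTernaryDer {F : Type*} [Field F] {n : ℕ} (i : Fin n)
    (h : IsTernaryDer (V00h F n) (Dop (V00h F n) (1, 0) (0, Pi.single i 1)
      (0, Pi.single i 1) (0, Pi.single i 1))) : (9 : F) = 0 := by
  have h := congrFun (congrArg Prod.snd (h (1, 0) (0, Pi.single i 1) (0, Pi.single i 1))) i
  simp [Dop, V00h, Pi.single_apply] at h
  grind

theorem not_isTernaryDer_of_ne {F : Type*} [Field F] {n : ℕ} {i j : Fin n} (hij : i ≠ j) :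
    ¬ IsTernaryDer (V00h F n) (Dop (V00h F n) (1, 0) (0, Pi.single j 1)
      (0, Pi.single i 1) (0, Pi.single i 1)) := by
  intro h
  have h := congrFun (congrArg Prod.snd (h (1, 0) (0, Pi.single i 1) (0, Pi.single i 1))) j
  simp [Dop, V00h, Pi.single_apply, hij, hij.symm] at h

/-- The ternary algebra `𝒱_{0,0,h}` is a ternary Jordan algebra if and only if
`char F = 3` and `n = 1`. -/
theorem V00h_isTernaryJordan_iff (F : Type*) [Field F] (n : ℕ) (hn : 1 ≤ n) :
    IsTernaryJordan (V00h F n) ↔ (ringChar F = 3 ∧ n = 1) := by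
  constructor
  · rintro ⟨-, h⟩
    constructor
    · have h9 : (9 : F) = 0 := nine_eq_zero_of_isTernaryDer ⟨0, hn⟩ (h _ _ _ _)
      have h3 : ((3 : ℕ) : F) = 0 := by
        push_cast
        exact pow_eq_zero_iff two_ne_zero |>.1 (by linear_combination h9 : (3 : F) ^ 2 = 0)
      exact ((Nat.dvd_prime Nat.prime_three).1 (ringChar.dvd h3)).resolve_left
        CharP.ringChar_ne_one
    · by_contra hn1
      exact not_isTernaryDer_of_ne (i := (⟨0, by omega⟩ : Fin n)) (j := ⟨1, by omega⟩)
        (by simp) (h _ _ _ _)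
  · rintro ⟨hF, rfl⟩
    have h3 : (3 : F) = 0 := by
      have := ringChar.Nat.cast_ringChar (R := F)
      rw [hF] at this
      exact_mod_cast this
    refine ⟨totComm_V00h F 1, fun x₂ x₃ y₂ y₃ a b c => ?_⟩
    simp only [Dop_V00h_one F h3]
    ext i <;> simp [V00h]
end

section
/- The ternary algebra 𝒱_{0,g,0} (f = 0, h = 0, g the standard trilinear form) is a ternary Jordan algebra if and only if char F = 2 and n = 1. -/
/-- The product of the ternary algebra `𝒱_{0,g,0}` on `F × Fⁿ`, where
`g(u,v,w) = ∑ᵢ uᵢvᵢwᵢ` is the standard trilinear form and `f = 0`, `h = 0`. -/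
def V0g0 (F : Type*) [Field F] (n : ℕ) :
    (F × (Fin n → F)) → (F × (Fin n → F)) → (F × (Fin n → F)) → (F × (Fin n → F)) :=
  fun x y z =>
    (x.1 * y.1 * z.1 + ∑ i, x.2 i * y.2 i * z.2 i,
      (y.1 * z.1) • x.2 + (x.1 * z.1) • y.2 + (x.1 * y.1) • z.2)

theorem V0g0_totComm (F : Type*) [Field F] (n : ℕ) : TotComm (V0g0 F n) := by
  have swap₁₂ (x y z) : V0g0 F n x y z = V0g0 F n y x z := by
    ext i
    · simp only [V0g0, mul_comm x.1 y.1, mul_comm (x.2 _) (y.2 _)]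
    · simp only [V0g0, Pi.add_apply, Pi.smul_apply, smul_eq_mul]
      ring
  have swap₂₃ (x y z) : V0g0 F n x y z = V0g0 F n x z y := by
    ext i
    · simp only [V0g0, mul_right_comm _ y.1 z.1, mul_right_comm _ (y.2 _) (z.2 _)]
    · simp only [V0g0, Pi.add_apply, Pi.smul_apply, smul_eq_mul]
      ring
  intro σ v
  have h₀₁ : σ 0 ≠ σ 1 := by simp
  have h₀₂ : σ 0 ≠ σ 2 := by simp
  have h₁₂ : σ 1 ≠ σ 2 := by simp
  generalize σ 0 = a at *
  generalize σ 1 = b at *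
  generalize σ 2 = c at *
  fin_cases a <;> fin_cases b <;> fin_cases c <;> first | contradiction | grind

/-- In characteristic two every commutator of right multiplications of `𝒱_{0,g,0}` with `n = 1`
is a derivation, because it is a scalar and `3 = 1`. -/
theorem V0g0_one_isTernaryDer_Dop {F : Type*} [Field F] (h2 : (2 : F) = 0)
    (x₂ x₃ y₂ y₃ : F × (Fin 1 → F)) :
    IsTernaryDer (V0g0 F 1) (Dop (V0g0 F 1) x₂ x₃ y₂ y₃) := by
  obtain ⟨d, hd⟩ : ∃ d : F, ∀ z, Dop (V0g0 F 1) x₂ x₃ y₂ y₃ z = d • z := by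
    refine ⟨(x₂.1 * x₃.2 0 + x₃.1 * x₂.2 0) * (y₂.2 0 * y₃.2 0) -
      (y₂.1 * y₃.2 0 + y₃.1 * y₂.2 0) * (x₂.2 0 * x₃.2 0), fun z => ?_⟩
    ext i
    · simp [Dop, V0g0]
      ring
    · obtain rfl := Subsingleton.elim i 0
      simp [Dop, V0g0]
      linear_combination (z.2 0) * ((y₂.1 * y₃.2 0 + y₃.1 * y₂.2 0) * (x₂.2 0 * x₃.2 0) -
        (x₂.1 * x₃.2 0 + x₃.1 * x₂.2 0) * (y₂.2 0 * y₃.2 0)) * h2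
  intro a b c
  simp only [hd]
  ext i
  · simp [V0g0]
    linear_combination -d * (a.1 * b.1 * c.1 + a.2 0 * b.2 0 * c.2 0) * h2
  · simp [V0g0]
    linear_combination
      -d * (b.1 * c.1 * a.2 i + a.1 * c.1 * b.2 i + a.1 * b.1 * c.2 i) * h2

theorem Dop_V0g0_single {F : Type*} [Field F] {n : ℕ} (i : Fin n) (z : F × (Fin n → F)) :
    Dop (V0g0 F n) (0, Pi.single i 1) (0, Pi.single i 1) (1, 0) (0, Pi.single i 1) z =
      (-z.1, Pi.single i (z.2 i)) := by
  ext j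
  · simp [Dop, V0g0, Pi.single_apply]
  · by_cases hj : j = i <;> simp [Dop, V0g0, Pi.single_apply, hj]

/-- The ternary algebra `𝒱_{0,g,0}` is a ternary Jordan algebra if and only if
`char F = 2` and `n = 1`. -/
theorem V0g0_isTernaryJordan_iff (F : Type*) [Field F] (n : ℕ) (hn : 1 ≤ n) :
    IsTernaryJordan (V0g0 F n) ↔ (ringChar F = 2 ∧ n = 1) := by
  constructor
  · rintro ⟨-, hder⟩
    have h2 : (2 : F) = 0 := by
      let i : Fin n := ⟨0, hn⟩
      have h := congrArg Prod.fst (hder (0, Pi.single i 1) (0, Pi.single i 1) (1, 0)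
        (0, Pi.single i 1) (1, 0) (1, 0) (1, 0))
      simp only [Dop_V0g0_single] at h
      simp [V0g0] at h
      linear_combination -h
    refine ⟨CharP.ringChar_of_prime_eq_zero Nat.prime_two (by exact_mod_cast h2), ?_⟩
    by_contra hne
    let i : Fin n := ⟨0, hn⟩
    let j : Fin n := ⟨1, by omega⟩
    have hij : i ≠ j := by simp [i, j]
    have h := congrArg Prod.fst (hder (0, Pi.single i 1) (0, Pi.single i 1) (1, 0)
      (0, Pi.single i 1) (0, Pi.single j 1) (0, Pi.single j 1) (0, Pi.single j 1))
    simp only [Dop_V0g0_single] at h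
    simp [V0g0, Pi.single_apply, hij] at h
  · rintro ⟨hchar, rfl⟩
    have h2 : (2 : F) = 0 := by
      have h := ringChar.Nat.cast_ringChar (R := F)
      rw [hchar] at h
      exact_mod_cast h
    exact ⟨V0g0_totComm F 1, V0g0_one_isTernaryDer_Dop h2⟩
end

section
/- The ternary algebra 𝒱_{f,0,h} (g = 0, f and h the standard bilinear forms) is a ternary Jordan algebra if and only if char F = 2 (for every n ≥ 1). -/
/-- The product of the ternary algebra `𝒱_{f,0,h}` on `F × Fⁿ`, where
`f(u,v) = h(u,v) = ∑ᵢ uᵢvᵢ` are the standard bilinear forms and `g = 0`. -/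
def Vf0h (F : Type*) [Field F] (n : ℕ) :
    (F × (Fin n → F)) → (F × (Fin n → F)) → (F × (Fin n → F)) → (F × (Fin n → F)) :=
  fun x y z =>
    (x.1 * y.1 * z.1 + x.1 * (∑ i, y.2 i * z.2 i) + y.1 * (∑ i, x.2 i * z.2 i)
        + z.1 * (∑ i, x.2 i * y.2 i),
      (y.1 * z.1 + ∑ i, y.2 i * z.2 i) • x.2 +
      (x.1 * z.1 + ∑ i, x.2 i * z.2 i) • y.2 +
      (x.1 * y.1 + ∑ i, x.2 i * y.2 i) • z.2)

/-- The ternary product `B(y,z)x + B(x,z)y + B(x,y)z` attached to a bilinear form `B`. -/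
def bilinTriple {R M : Type*} [CommRing R] [AddCommGroup M] [Module R M]
    (B : LinearMap.BilinForm R M) (x y z : M) : M :=
  B y z • x + B x z • y + B x y • z

section bilinTriple

variable {R M : Type*} [CommRing R] [AddCommGroup M] [Module R M] {B : LinearMap.BilinForm R M}

theorem bilinTriple_totComm (hB : B.IsSymm) : TotComm (bilinTriple B) := by
  intro σ v
  have h10 : B (v 1) (v 0) = B (v 0) (v 1) := hB.eq _ _
  have h20 : B (v 2) (v 0) = B (v 0) (v 2) := hB.eq _ _
  have h21 : B (v 2) (v 1) = B (v 1) (v 2) := hB.eq _ _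
  have h01 : σ 0 ≠ σ 1 := σ.injective.ne (by decide)
  have h02 : σ 0 ≠ σ 2 := σ.injective.ne (by decide)
  have h12 : σ 1 ≠ σ 2 := σ.injective.ne (by decide)
  generalize σ 0 = i, σ 1 = j, σ 2 = k at *
  fin_cases i <;> fin_cases j <;> first | exact absurd rfl h01 | skip
  all_goals fin_cases k <;> first | exact absurd rfl h02 | exact absurd rfl h12 | skip
  all_goals simp [bilinTriple, h10, h20, h21] <;> abel

/-- Right multiplications of `bilinTriple B` are self-adjoint for `B`. -/
theorem apply_bilinTriple_left (hB : B.IsSymm) (a b x y : M) :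
    B (bilinTriple B a x y) b = B a (bilinTriple B b x y) := by
  have hs : ∀ x y, B x y = B y x := fun x y => hB.eq x y
  simp only [bilinTriple, map_add, map_smul, LinearMap.add_apply, LinearMap.smul_apply,
    smul_eq_mul]
  rw [hs x b, hs y b]
  ring

theorem Dop_bilinTriple_skew (hB : B.IsSymm) (x₂ x₃ y₂ y₃ a b : M) :
    B (Dop (bilinTriple B) x₂ x₃ y₂ y₃ a) b + B a (Dop (bilinTriple B) x₂ x₃ y₂ y₃ b) = 0 := by
  simp only [Dop, map_sub, LinearMap.sub_apply, apply_bilinTriple_left hB]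
  ring

theorem bilinTriple_add_smul_left (r s t : R) (a b c x y : M) :
    bilinTriple B (r • a + s • b + t • c) x y =
      r • bilinTriple B a x y + s • bilinTriple B b x y + t • bilinTriple B c x y := by
  simp only [bilinTriple, map_add, map_smul, LinearMap.add_apply, LinearMap.smul_apply,
    smul_eq_mul]
  module

theorem Dop_bilinTriple_add_smul (x₂ x₃ y₂ y₃ : M) (r s t : R) (a b c : M) :
    Dop (bilinTriple B) x₂ x₃ y₂ y₃ (r • a + s • b + t • c) =
      r • Dop (bilinTriple B) x₂ x₃ y₂ y₃ a + s • Dop (bilinTriple B) x₂ x₃ y₂ y₃ b +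
        t • Dop (bilinTriple B) x₂ x₃ y₂ y₃ c := by
  simp only [Dop, bilinTriple_add_smul_left]
  module

/-- The ternary algebra of a symmetric bilinear form is a ternary Jordan algebra. -/
theorem isTernaryJordan_bilinTriple (hB : B.IsSymm) : IsTernaryJordan (bilinTriple B) := by
  refine ⟨bilinTriple_totComm hB, fun x₂ x₃ y₂ y₃ a b c => ?_⟩
  have hskew := Dop_bilinTriple_skew hB x₂ x₃ y₂ y₃
  have hlin : Dop (bilinTriple B) x₂ x₃ y₂ y₃ (bilinTriple B a b c) = _ :=
    Dop_bilinTriple_add_smul x₂ x₃ y₂ y₃ (B b c) (B a c) (B a b) a b c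
  rw [hlin]
  generalize Dop (bilinTriple B) x₂ x₃ y₂ y₃ = D at hskew
  simp only [bilinTriple]
  rw [eq_neg_of_add_eq_zero_left (hskew a b), eq_neg_of_add_eq_zero_left (hskew a c),
    eq_neg_of_add_eq_zero_left (hskew b c)]
  module

end bilinTriple

/-- The standard symmetric bilinear form on `F × Fⁿ`. -/
def stdForm (F : Type*) [Field F] (n : ℕ) : LinearMap.BilinForm F (F × (Fin n → F)) :=
  LinearMap.mk₂ F (fun x y => x.1 * y.1 + x.2 ⬝ᵥ y.2)
    (fun x y z => by simp only [Prod.fst_add, Prod.snd_add, add_dotProduct]; ring)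
    (fun c x y => by simp only [Prod.smul_fst, Prod.smul_snd, smul_dotProduct, smul_eq_mul]; ring)
    (fun x y z => by simp only [Prod.fst_add, Prod.snd_add, dotProduct_add]; ring)
    (fun c x y => by simp only [Prod.smul_fst, Prod.smul_snd, dotProduct_smul, smul_eq_mul]; ring)

theorem stdForm_isSymm (F : Type*) [Field F] (n : ℕ) : (stdForm F n).IsSymm :=
  ⟨fun x y => by simp [stdForm, dotProduct_comm x.2, mul_comm x.1]⟩

theorem Vf0h_eq_bilinTriple (F : Type*) [Field F] [CharP F 2] (n : ℕ) :
    Vf0h F n = bilinTriple (stdForm F n) := by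
  have h2 : (2 : F) = 0 := CharTwo.two_eq_zero
  funext x y z
  ext i
  · simp only [Vf0h, bilinTriple, stdForm, LinearMap.mk₂_apply, dotProduct, Prod.fst_add,
      Prod.smul_fst, smul_eq_mul]
    linear_combination (-x.1 * y.1 * z.1) * h2
  · simp [Vf0h, bilinTriple, stdForm, dotProduct]

/-- Evaluating the derivation identity for `D = [R_{(e,v)}, R_{(v,v)}]` at `⟦e,e,e⟧`, where
`e = (1, 0)` and `v` is a unit coordinate vector, gives `4 = 0`. -/
theorem two_eq_zero_of_isTernaryJordan_Vf0h {F : Type*} [Field F] {n : ℕ} (hn : 1 ≤ n)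
    (h : IsTernaryJordan (Vf0h F n)) : (2 : F) = 0 := by
  let i : Fin n := ⟨0, hn⟩
  let e : F × (Fin n → F) := (1, 0)
  let v : F × (Fin n → F) := (0, Pi.single i 1)
  have key := congrArg (fun w => w.2 i) (h.2 e v v v e e e)
  simp [Dop, Vf0h, e, v, Pi.single_apply] at key
  have h4 : (2 : F) * 2 = 0 := by linear_combination key
  simpa using h4

/-- For every `n ≥ 1`, the ternary algebra `𝒱_{f,0,h}` is a ternary Jordan
algebra if and only if `char F = 2`. -/
theorem Vf0h_isTernaryJordan_iff (F : Type*) [Field F] (n : ℕ) (hn : 1 ≤ n) :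
    IsTernaryJordan (Vf0h F n) ↔ ringChar F = 2 := by
  constructor
  · intro h
    have h2 := two_eq_zero_of_isTernaryJordan_Vf0h hn h
    exact CharP.ringChar_of_prime_eq_zero Nat.prime_two (by exact_mod_cast h2)
  · intro h
    have : CharP F 2 := ringChar.of_eq h
    rw [Vf0h_eq_bilinTriple]
    exact isTernaryJordan_bilinTriple (stdForm_isSymm F n)
end

section
/- In the ternary algebra 𝒱_{0,0,0} over a field F (any n ≥ 1): every subspace of {0} × Fⁿ is an ideal of 𝒱_{0,0,0}, and every ideal of 𝒱_{0,0,0} different from the whole algebra is contained in {0} × Fⁿ; in particular 𝒱_{0,0,0} is not simple. -/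
/-- An ideal of a ternary algebra `(W, p)`: a subspace `I` with
`p I W W ⊆ I`, `p W I W ⊆ I` and `p W W I ⊆ I`. -/
def IsTernaryIdeal (F : Type*) {W : Type*} [Field F] [AddCommGroup W] [Module F W]
    (p : W → W → W → W) (I : Submodule F W) : Prop :=
  (∀ a ∈ I, ∀ b c, p a b c ∈ I) ∧ (∀ b, ∀ a ∈ I, ∀ c, p b a c ∈ I) ∧
    (∀ b c, ∀ a ∈ I, p b c a ∈ I)

/-- A ternary algebra is simple if its product is nonzero and its only ideals
are `0` and the whole algebra. -/
def IsTernarySimple (F : Type*) {W : Type*} [Field F] [AddCommGroup W] [Module F W]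
    (p : W → W → W → W) : Prop :=
  (∃ a b c, p a b c ≠ 0) ∧
    ∀ I : Submodule F W, IsTernaryIdeal F p I → I = ⊥ ∨ I = ⊤

/-- The product of the ternary algebra `𝒱_{0,0,0}` on `F × Fⁿ`. -/
def V000 (F : Type*) [Field F] (n : ℕ) :
    (F × (Fin n → F)) → (F × (Fin n → F)) → (F × (Fin n → F)) → (F × (Fin n → F)) :=
  fun x y z =>
    (x.1 * y.1 * z.1, (y.1 * z.1) • x.2 + (x.1 * z.1) • y.2 + (x.1 * y.1) • z.2)

theorem V000_isTernaryIdeal_of_le {F : Type*} [Field F] {n : ℕ}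
    {I : Submodule F (F × (Fin n → F))}
    (hI : I ≤ Submodule.prod (⊥ : Submodule F F) (⊤ : Submodule F (Fin n → F))) :
    IsTernaryIdeal F (V000 F n) I := by
  have fst_eq_zero : ∀ a ∈ I, a.1 = 0 := fun a ha => (hI ha).1
  refine ⟨fun a ha b c => ?_, fun b a ha c => ?_, fun b c a ha => ?_⟩
  · convert I.smul_mem (b.1 * c.1) ha using 1
    simp [V000, Prod.ext_iff, fst_eq_zero a ha]
  · convert I.smul_mem (b.1 * c.1) ha using 1
    simp [V000, Prod.ext_iff, fst_eq_zero a ha]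
  · convert I.smul_mem (b.1 * c.1) ha using 1
    simp [V000, Prod.ext_iff, fst_eq_zero a ha]

theorem V000_ideal_eq_top {F : Type*} [Field F] {n : ℕ}
    {I : Submodule F (F × (Fin n → F))} (hI : IsTernaryIdeal F (V000 F n) I)
    {w : F × (Fin n → F)} (hw : w ∈ I) (hw₁ : w.1 ≠ 0) : I = ⊤ := by
  have zero_prod_mem (u : Fin n → F) : ((0, u) : F × (Fin n → F)) ∈ I := by
    simpa [V000, hw₁] using hI.1 w hw (0, w.1⁻¹ • u) (1, 0)
  refine (Submodule.eq_top_iff').2 fun x => ?_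
  have h := I.add_mem (I.smul_mem (x.1 * w.1⁻¹) hw)
    (zero_prod_mem (x.2 - (x.1 * w.1⁻¹) • w.2))
  convert h using 1
  simp [Prod.ext_iff, hw₁]

/-- Every subspace of `{0} × Fⁿ` is an ideal of `𝒱_{0,0,0}`; every ideal of
`𝒱_{0,0,0}` different from the whole algebra is contained in `{0} × Fⁿ`; in
particular `𝒱_{0,0,0}` is not simple. -/
theorem V000_ideals (F : Type*) [Field F] (n : ℕ) (hn : 1 ≤ n) :
    (∀ I : Submodule F (F × (Fin n → F)),
        I ≤ Submodule.prod (⊥ : Submodule F F) (⊤ : Submodule F (Fin n → F)) →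
        IsTernaryIdeal F (V000 F n) I) ∧
    (∀ I : Submodule F (F × (Fin n → F)),
        IsTernaryIdeal F (V000 F n) I → I ≠ ⊤ →
        I ≤ Submodule.prod (⊥ : Submodule F F) (⊤ : Submodule F (Fin n → F))) ∧
    ¬ IsTernarySimple F (V000 F n) := by
  have le_of_ne_top : ∀ I : Submodule F (F × (Fin n → F)),
      IsTernaryIdeal F (V000 F n) I → I ≠ ⊤ →
      I ≤ Submodule.prod (⊥ : Submodule F F) (⊤ : Submodule F (Fin n → F)) :=
    fun I hI hne w hw =>
      ⟨by_contra fun h => hne (V000_ideal_eq_top hI hw h), Submodule.mem_top⟩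
  refine ⟨fun I => V000_isTernaryIdeal_of_le, le_of_ne_top, fun h => ?_⟩
  rcases h.2 _ (V000_isTernaryIdeal_of_le le_rfl) with h | h
  · have hmem : ((0, fun _ => 1) : F × (Fin n → F)) ∈
        Submodule.prod (⊥ : Submodule F F) (⊤ : Submodule F (Fin n → F)) := by simp
    rw [h, Submodule.mem_bot, Prod.ext_iff] at hmem
    exact one_ne_zero (congrFun hmem.2 ⟨0, hn⟩)
  · have hmem : ((1, 0) : F × (Fin n → F)) ∈
        Submodule.prod (⊥ : Submodule F F) (⊤ : Submodule F (Fin n → F)) :=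
      h ▸ Submodule.mem_top
    exact one_ne_zero hmem.1
end

section
/- Let F be a field with char F ≠ 2 and n ≥ 1. A linear endomorphism D of F × Fⁿ is a derivation of the ternary algebra 𝒱_{0,0,0} if and only if D(1) = 0 and D({0} × Fⁿ) ⊆ {0} × Fⁿ, the restriction of D to {0} × Fⁿ being an arbitrary linear endomorphism of Fⁿ; hence Der(𝒱_{0,0,0}) ≅ End(Fⁿ)⁽⁻⁾ as Lie algebras. -/
namespace V000

variable {F : Type*} [Field F] {n : ℕ} {D : (F × (Fin n → F)) →ₗ[F] (F × (Fin n → F))}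

/-- In characteristic different from `2`, a derivation of `𝒱_{0,0,0}` kills `1`. -/
theorem der_map_one (h2 : (2 : F) ≠ 0) (h : IsTernaryDer (V000 F n) ⇑D) :
    D (1, 0) = 0 := by
  have h1 := h (1, 0) (1, 0) (1, 0)
  simp only [V000, mul_one, one_mul, one_smul, smul_zero, add_zero, zero_add] at h1
  have h3 : (2 : F) • D (1, 0) = 0 := by
    simp only [Prod.mk.eta] at h1
    rw [two_smul]
    exact left_eq_add.mp (h1.trans (add_assoc _ _ _))
  exact (smul_eq_zero.mp h3).resolve_left h2

/-- In characteristic different from `2`, a derivation of `𝒱_{0,0,0}` preserves `{0} × Fⁿ`. -/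
theorem der_fst_map_inr (h2 : (2 : F) ≠ 0) (h : IsTernaryDer (V000 F n) ⇑D)
    (v : Fin n → F) : (D (0, v)).1 = 0 := by
  have h1 := congrArg Prod.snd (h (0, v) (0, v) (1, 0))
  simp only [V000, der_map_one h2 h] at h1
  have h3 : (2 * (D (0, v)).1) • v = 0 := by
    simpa [two_mul, add_smul, ← Prod.zero_eq_mk] using h1.symm
  rcases smul_eq_zero.mp h3 with h4 | rfl
  · exact (mul_eq_zero.mp h4).resolve_left h2
  · rw [← Prod.zero_eq_mk, map_zero, Prod.fst_zero]

theorem map_eq_of_map_one (h1 : D (1, 0) = 0) (hv : ∀ v, (D (0, v)).1 = 0)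
    (x : F × (Fin n → F)) : D x = (0, (D (0, x.2)).2) := by
  have hx : x = x.1 • (1, 0) + (0, x.2) := by ext <;> simp
  conv_lhs => rw [hx, map_add, map_smul, h1, smul_zero, zero_add]
  exact Prod.ext (hv _) rfl

theorem isTernaryDer_of_map_one (h1 : D (1, 0) = 0) (hv : ∀ v, (D (0, v)).1 = 0) :
    IsTernaryDer (V000 F n) ⇑D := by
  have key : ∀ x, D x = (0, (LinearMap.snd F F _ ∘ₗ D ∘ₗ LinearMap.inr F F _) x.2) :=
    map_eq_of_map_one h1 hv
  intro a b c
  simp only [key, V000, map_add, map_smul]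
  ext <;> simp

theorem isTernaryDer_iff (h2 : (2 : F) ≠ 0) :
    IsTernaryDer (V000 F n) ⇑D ↔ D (1, 0) = 0 ∧ ∀ v, (D (0, v)).1 = 0 :=
  ⟨fun h => ⟨der_map_one h2 h, der_fst_map_inr h2 h⟩,
    fun h => isTernaryDer_of_map_one h.1 h.2⟩

end V000

/-- For `char F ≠ 2`: a linear endomorphism `D` of `F × Fⁿ` is a derivation of
`𝒱_{0,0,0}` iff `D(1) = 0` and `D` maps `{0} × Fⁿ` into itself (the restriction
to `{0} × Fⁿ` being arbitrary); moreover the restriction map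
`D ↦ D|_{Fⁿ}` is a bijection from `Der(𝒱_{0,0,0})` onto `End(Fⁿ)` which sends
commutators to commutators, i.e. `Der(𝒱_{0,0,0}) ≅ End(Fⁿ)⁽⁻⁾` as Lie
algebras. -/
theorem V000_der_eq_end (F : Type*) [Field F] (hF : ringChar F ≠ 2) (n : ℕ) (hn : 1 ≤ n) :
    (∀ D : (F × (Fin n → F)) →ₗ[F] (F × (Fin n → F)),
      IsTernaryDer (V000 F n) ⇑D ↔
        (D ((1 : F), (0 : Fin n → F)) = 0 ∧
          ∀ v : Fin n → F, (D ((0 : F), v)).1 = 0)) ∧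
    Function.Bijective
      (fun D : {D : (F × (Fin n → F)) →ₗ[F] (F × (Fin n → F)) //
          IsTernaryDer (V000 F n) ⇑D} =>
        LinearMap.snd F F (Fin n → F) ∘ₗ D.1 ∘ₗ LinearMap.inr F F (Fin n → F)) ∧
    (∀ D₁ D₂ : {D : (F × (Fin n → F)) →ₗ[F] (F × (Fin n → F)) //
        IsTernaryDer (V000 F n) ⇑D},
      LinearMap.snd F F (Fin n → F) ∘ₗ (D₁.1 ∘ₗ D₂.1 - D₂.1 ∘ₗ D₁.1) ∘ₗ
          LinearMap.inr F F (Fin n → F) =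
        (LinearMap.snd F F (Fin n → F) ∘ₗ D₁.1 ∘ₗ LinearMap.inr F F (Fin n → F)) ∘ₗ
            (LinearMap.snd F F (Fin n → F) ∘ₗ D₂.1 ∘ₗ LinearMap.inr F F (Fin n → F)) -
          (LinearMap.snd F F (Fin n → F) ∘ₗ D₂.1 ∘ₗ LinearMap.inr F F (Fin n → F)) ∘ₗ
            (LinearMap.snd F F (Fin n → F) ∘ₗ D₁.1 ∘ₗ LinearMap.inr F F (Fin n → F))) := by
  have h2 : (2 : F) ≠ 0 := Ring.two_ne_zero hF
  have key : ∀ (D : {D : (F × (Fin n → F)) →ₗ[F] (F × (Fin n → F)) //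
      IsTernaryDer (V000 F n) ⇑D}) (x : F × (Fin n → F)), D.1 x = (0, (D.1 (0, x.2)).2) :=
    fun D => V000.map_eq_of_map_one (V000.der_map_one h2 D.2)
      (V000.der_fst_map_inr h2 D.2)
  refine ⟨fun D => V000.isTernaryDer_iff h2, ⟨fun D₁ D₂ h => ?_, fun L => ?_⟩, fun D₁ D₂ => ?_⟩
  · refine Subtype.ext (LinearMap.ext fun x => ?_)
    rw [key D₁, key D₂]
    exact Prod.ext rfl (LinearMap.congr_fun h x.2)
  · exact ⟨⟨LinearMap.inr F F _ ∘ₗ L ∘ₗ LinearMap.snd F F _,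
      V000.isTernaryDer_of_map_one (by simp) (by simp)⟩, rfl⟩
  · refine LinearMap.ext fun v => ?_
    simp only [LinearMap.comp_apply, LinearMap.sub_apply, LinearMap.inr_apply,
      LinearMap.snd_apply, Prod.snd_sub]
    rw [key D₁ (D₂.1 (0, v)), key D₂ (D₁.1 (0, v))]
end

section
/- Let F be a field of characteristic 0 and n ≥ 1. The ternary algebra 𝔸 is a ternary Jordan algebra: for all x₂,x₃,y₂,y₃ ∈ Fⁿ, the operator D_{x,y} = [R_{(x₂,x₃)}, R_{(y₂,y₃)}] satisfies D_{x,y}⟦z₁,z₂,z₃⟧ = ⟦D_{x,y}z₁,z₂,z₃⟧ + ⟦z₁,D_{x,y}z₂,z₃⟧ + ⟦z₁,z₂,D_{x,y}z₃⟧ for all z₁,z₂,z₃ ∈ Fⁿ. -/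
/-- The ternary algebra `𝔸` on `V = Fⁿ`: with `(x,y) = ∑ᵢ xᵢyᵢ` the standard
symmetric bilinear form, `⟦x,y,z⟧ = (y,z)x + (x,z)y + (x,y)z`. -/
def tpA (F : Type*) [Field F] (n : ℕ) :
    (Fin n → F) → (Fin n → F) → (Fin n → F) → (Fin n → F) :=
  fun x y z => (∑ i, y i * z i) • x + (∑ i, x i * z i) • y + (∑ i, x i * y i) • z

section TernaryProduct

variable {F : Type*} [Field F] {n : ℕ}

theorem tpA_eq_dotProduct (x y z : Fin n → F) :
    tpA F n x y z = (y ⬝ᵥ z) • x + (x ⬝ᵥ z) • y + (x ⬝ᵥ y) • z := rfl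

theorem tpA_swap_left (x y z : Fin n → F) : tpA F n y x z = tpA F n x y z := by
  simp only [tpA_eq_dotProduct, dotProduct_comm y x]
  abel

theorem tpA_swap_right (x y z : Fin n → F) : tpA F n x z y = tpA F n x y z := by
  simp only [tpA_eq_dotProduct, dotProduct_comm z y]
  abel

variable (F n) in
theorem totComm_tpA : TotComm (tpA F n) := by
  intro σ v
  have h01 : σ 0 ≠ σ 1 := σ.injective.ne (by decide)
  have h02 : σ 0 ≠ σ 2 := σ.injective.ne (by decide)
  have h12 : σ 1 ≠ σ 2 := σ.injective.ne (by decide)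
  generalize σ 0 = i at *
  generalize σ 1 = j at *
  generalize σ 2 = k at *
  have hl := @tpA_swap_left F _ n
  have hr := @tpA_swap_right F _ n
  fin_cases i <;> fin_cases j <;> fin_cases k <;> simp at h01 h02 h12 ⊢ <;> grind

/-- The right multiplication operator `z ↦ ⟦z,x,y⟧` as a linear map. -/
def tpAMulRight (x y : Fin n → F) : Module.End F (Fin n → F) where
  toFun z := tpA F n z x y
  map_add' a b := by
    simp only [tpA_eq_dotProduct, add_dotProduct]
    module
  map_smul' c a := by
    simp only [tpA_eq_dotProduct, smul_dotProduct, smul_eq_mul, RingHom.id_apply]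
    module

theorem tpAMulRight_dotProduct (x y a b : Fin n → F) :
    tpAMulRight x y a ⬝ᵥ b = a ⬝ᵥ tpAMulRight x y b := by
  simp only [tpAMulRight, LinearMap.coe_mk, AddHom.coe_mk, tpA_eq_dotProduct, add_dotProduct,
    dotProduct_add, smul_dotProduct, dotProduct_smul, smul_eq_mul, dotProduct_comm b]
  rw [dotProduct_comm x b, dotProduct_comm y b]
  ring

/-- The commutator of two self-adjoint operators is skew-adjoint. -/
theorem lie_dotProduct_of_selfAdjoint {f g : Module.End F (Fin n → F)}
    (hf : ∀ a b, f a ⬝ᵥ b = a ⬝ᵥ f b) (hg : ∀ a b, g a ⬝ᵥ b = a ⬝ᵥ g b) (a b : Fin n → F) :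
    ⁅f, g⁆ a ⬝ᵥ b = -(a ⬝ᵥ ⁅f, g⁆ b) := by
  simp only [Ring.lie_def, LinearMap.sub_apply, Module.End.mul_apply, sub_dotProduct,
    dotProduct_sub, hf, hg, neg_sub]

theorem Dop_tpA (x₂ x₃ y₂ y₃ : Fin n → F) :
    Dop (tpA F n) x₂ x₃ y₂ y₃ = ⁅tpAMulRight y₂ y₃, tpAMulRight x₂ x₃⁆ := rfl

/-- A skew-adjoint operator is a derivation of `𝔸`. -/
theorem isTernaryDer_tpA_of_skew (D : Module.End F (Fin n → F))
    (hD : ∀ a b, D a ⬝ᵥ b = -(a ⬝ᵥ D b)) : IsTernaryDer (tpA F n) D := by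
  intro a b c
  simp only [tpA_eq_dotProduct, map_add, map_smul, hD]
  module

end TernaryProduct

/-- Over a field of characteristic 0, `𝔸` is a ternary Jordan algebra: the
product is totally commutative and every `D_{x,y} = [R_{(x₂,x₃)},R_{(y₂,y₃)}]`
is a derivation. -/
theorem tpA_isTernaryJordan (F : Type*) [Field F] [CharZero F] (n : ℕ) (hn : 1 ≤ n) :
    IsTernaryJordan (tpA F n) ∧
    ∀ x₂ x₃ y₂ y₃ : Fin n → F, IsTernaryDer (tpA F n) (Dop (tpA F n) x₂ x₃ y₂ y₃) := by
  have hder : ∀ x₂ x₃ y₂ y₃ : Fin n → F,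
      IsTernaryDer (tpA F n) (Dop (tpA F n) x₂ x₃ y₂ y₃) := by
    intro x₂ x₃ y₂ y₃
    rw [Dop_tpA]
    exact isTernaryDer_tpA_of_skew _
      (lie_dotProduct_of_selfAdjoint (tpAMulRight_dotProduct _ _) (tpAMulRight_dotProduct _ _))
  exact ⟨⟨totComm_tpA F n, hder⟩, hder⟩
end

section
/- Let F be a field of characteristic 0 and n = 2. If α₁,…,α₁₀ ∈ F are such that α₁⟦⟦x,y,z⟧,u,v⟧ + α₂⟦⟦x,y,u⟧,z,v⟧ + α₃⟦⟦x,y,v⟧,z,u⟧ + α₄⟦⟦x,z,u⟧,y,v⟧ + α₅⟦⟦x,z,v⟧,y,u⟧ + α₆⟦⟦x,u,v⟧,y,z⟧ + α₇⟦⟦y,z,u⟧,x,v⟧ + α₈⟦⟦y,z,v⟧,x,u⟧ + α₉⟦⟦y,u,v⟧,x,z⟧ + α₁₀⟦⟦z,u,v⟧,x,y⟧ = 0 holds for all x,y,z,u,v ∈ F², then α₁ = α₂ = ⋯ = α₁₀ = 0. (Hence the only degree-2 identities of 𝔸 are those obtained by lifting total commutativity.) -/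
/-- For `char F = 0` and `n = 2`: if a linear combination of the ten
symmetrized degree-2 monomials vanishes identically on `𝔸`, then all ten
coefficients are zero. Hence the only degree-2 identities of `𝔸` are those
obtained by lifting total commutativity. -/
theorem tpA_degree_two_identities (F : Type*) [Field F] [CharZero F]
    (α₁ α₂ α₃ α₄ α₅ α₆ α₇ α₈ α₉ α₁₀ : F)
    (h : ∀ x y z u v : Fin 2 → F,
      α₁ • tpA F 2 (tpA F 2 x y z) u v + α₂ • tpA F 2 (tpA F 2 x y u) z v +
      α₃ • tpA F 2 (tpA F 2 x y v) z u + α₄ • tpA F 2 (tpA F 2 x z u) y v +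
      α₅ • tpA F 2 (tpA F 2 x z v) y u + α₆ • tpA F 2 (tpA F 2 x u v) y z +
      α₇ • tpA F 2 (tpA F 2 y z u) x v + α₈ • tpA F 2 (tpA F 2 y z v) x u +
      α₉ • tpA F 2 (tpA F 2 y u v) x z + α₁₀ • tpA F 2 (tpA F 2 z u v) x y = 0) :
    α₁ = 0 ∧ α₂ = 0 ∧ α₃ = 0 ∧ α₄ = 0 ∧ α₅ = 0 ∧
      α₆ = 0 ∧ α₇ = 0 ∧ α₈ = 0 ∧ α₉ = 0 ∧ α₁₀ = 0 := by
  have h00000 := congrFun (h ![1, 0] ![1, 0] ![1, 0] ![1, 0] ![1, 0]) 0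
  have h00001 := congrFun (h ![1, 0] ![1, 0] ![1, 0] ![1, 0] ![0, 1]) 1
  have h00010 := congrFun (h ![1, 0] ![1, 0] ![1, 0] ![0, 1] ![1, 0]) 1
  have h00011 := congrFun (h ![1, 0] ![1, 0] ![1, 0] ![0, 1] ![0, 1]) 0
  have h00100 := congrFun (h ![1, 0] ![1, 0] ![0, 1] ![1, 0] ![1, 0]) 1
  have h00101 := congrFun (h ![1, 0] ![1, 0] ![0, 1] ![1, 0] ![0, 1]) 0
  have h00110 := congrFun (h ![1, 0] ![1, 0] ![0, 1] ![0, 1] ![1, 0]) 0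
  have h01000 := congrFun (h ![1, 0] ![0, 1] ![1, 0] ![1, 0] ![1, 0]) 1
  have h01001 := congrFun (h ![1, 0] ![0, 1] ![1, 0] ![1, 0] ![0, 1]) 0
  have h01010 := congrFun (h ![1, 0] ![0, 1] ![1, 0] ![0, 1] ![1, 0]) 0
  clear h
  simp [tpA, Fin.sum_univ_two] at h00000 h00001 h00010 h00011 h00100 h00101 h00110 h01000 h01001 h01010
  refine ⟨?_, ?_, ?_, ?_, ?_, ?_, ?_, ?_, ?_, ?_⟩ <;> grind
end

section
/- Let F be a field of characteristic 0 and n ≥ 2. The ternary algebra 𝔸 does not satisfy the Jordan triple system identity: there exist x,y,z,u,v ∈ Fⁿ such that ⟦⟦x,y,z⟧,u,v⟧ + ⟦z,u,⟦x,y,v⟧⟧ ≠ ⟦x,y,⟦z,u,v⟧⟧ + ⟦z,⟦y,x,u⟧,v⟧. -/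
/-- For `char F = 0` and `n ≥ 2`, the ternary algebra `𝔸` does not satisfy the
Jordan triple system identity. -/
theorem tpA_not_jordan_triple (F : Type*) [Field F] [CharZero F] (n : ℕ) (hn : 2 ≤ n) :
    ∃ x y z u v : Fin n → F,
      tpA F n (tpA F n x y z) u v + tpA F n z u (tpA F n x y v) ≠
        tpA F n x y (tpA F n z u v) + tpA F n z (tpA F n y x u) v := by
  let i : Fin n := ⟨0, by omega⟩
  let j : Fin n := ⟨1, by omega⟩
  have hij : i ≠ j := by simp [i, j]
  refine ⟨Pi.single i 1, Pi.single i 1, Pi.single i 1, Pi.single j 1, Pi.single i 1, fun h => ?_⟩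
  have hj := congrFun h j
  simp [tpA, Pi.single_apply, hij, hij.symm] at hj
  norm_num at hj
end

section
/- Let F be a field of characteristic 0 and n ≥ 1. A linear endomorphism D of Fⁿ is a derivation of the ternary Jordan algebra 𝔸 if and only if D is skew-symmetric with respect to the standard form, i.e. (D(x),y) + (x,D(y)) = 0 for all x,y ∈ Fⁿ; hence Der(𝔸) = so(n). -/
/-- A linear map `D` is a derivation of `𝔸` iff the symmetric form
`S(x, y) = (D x, y) + (x, D y)` satisfies `S(y, z) x + S(x, z) y + S(x, y) z = 0`. -/
theorem isTernaryDer_tpA_iff {F : Type*} [Field F] {n : ℕ}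
    (D : (Fin n → F) →ₗ[F] (Fin n → F)) :
    IsTernaryDer (tpA F n) ⇑D ↔ ∀ x y z : Fin n → F,
      (D y ⬝ᵥ z + y ⬝ᵥ D z) • x + (D x ⬝ᵥ z + x ⬝ᵥ D z) • y
        + (D x ⬝ᵥ y + x ⬝ᵥ D y) • z = 0 := by
  refine forall_congr' fun x => forall_congr' fun y => forall_congr' fun z => ?_
  simp only [tpA, dotProduct, map_add, map_smul]
  rw [eq_comm, ← sub_eq_zero]
  refine Eq.congr ?_ rfl
  module

/-- For `char F = 0`: a linear endomorphism `D` of `Fⁿ` is a derivation of the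
ternary Jordan algebra `𝔸` iff `D` is skew-symmetric with respect to the
standard form, i.e. `(D(x),y) + (x,D(y)) = 0` for all `x, y`; hence
`Der(𝔸) = so(n)`. -/
theorem tpA_der_iff_skew (F : Type*) [Field F] [CharZero F] (n : ℕ) (hn : 1 ≤ n) :
    ∀ D : (Fin n → F) →ₗ[F] (Fin n → F),
      IsTernaryDer (tpA F n) ⇑D ↔
        ∀ x y : Fin n → F, (∑ i, D x i * y i) + (∑ i, x i * D y i) = 0 := by
  intro D
  change _ ↔ ∀ x y : Fin n → F, D x ⬝ᵥ y + x ⬝ᵥ D y = 0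
  rw [isTernaryDer_tpA_iff]
  refine ⟨fun h x y => ?_, fun h x y z => by simp [h]⟩
  rcases eq_or_ne x 0 with rfl | hx
  · simp
  have hxx : D x ⬝ᵥ x + x ⬝ᵥ D x = 0 := by
    have h₃ : (3 * (D x ⬝ᵥ x + x ⬝ᵥ D x)) • x = 0 := by
      rw [← h x x x]
      module
    simpa [hx] using h₃
  have h₂ : (2 * (D x ⬝ᵥ y + x ⬝ᵥ D y)) • x = 0 := by
    have := h x x y
    rw [hxx, zero_smul, add_zero] at this
    rw [← this]
    module
  simpa [hx] using h₂
end

section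
/- In the ternary algebra 𝒟₂ on the generalized quaternions ℍ(a,b), every operator D_{x,y} = [R_{(x₁,x₂)}, R_{(y₁,y₂)}] is a derivation of ⟦·,·,·⟧ (i.e. 𝒟₂ is a ternary D_{x,y}-derivation algebra); moreover, if the norm form of ℍ(a,b) is anisotropic (x·x̄ = 0 implies x = 0), then 𝒟₂ is simple. -/
open Quaternion in
/-- The ternary product `⟦x,y,z⟧ = (x·ȳ)·z` on the generalized quaternion
algebra `ℍ(a,b)` (with `i² = a`, `j² = b`, `ij = −ji`). -/
def tq {F : Type*} [Field F] {a b : F} (x y z : ℍ[F,a,b]) : ℍ[F,a,b] :=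
  x * star y * z

open Quaternion in
theorem star_commutator {F : Type*} [Field F] {a b : F} (u v : ℍ[F,a,b]) :
    star (u * v - v * u) = -(u * v - v * u) := by
  ext <;> simp <;> ring

open Quaternion in
theorem Dop_tq {F : Type*} [Field F] {a b : F} (x₁ x₂ y₁ y₂ z : ℍ[F,a,b]) :
    Dop tq x₁ x₂ y₁ y₂ z =
      z * (star x₁ * x₂ * (star y₁ * y₂) - star y₁ * y₂ * (star x₁ * x₂)) := by
  simp only [Dop, tq]
  noncomm_ring

open Quaternion in
/-- Right multiplication by a skew element is a derivation of `⟦x,y,z⟧ = (x·ȳ)·z`. -/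
theorem isTernaryDer_mul_right_of_star_eq_neg {F : Type*} [Field F] {a b : F} {w : ℍ[F,a,b]}
    (hw : star w = -w) : IsTernaryDer tq (fun z : ℍ[F,a,b] => z * w) := by
  intro x y z
  simp only [tq, star_mul, hw]
  noncomm_ring

open Quaternion in
theorem ternaryIdeal_eq_bot_or_top {F : Type*} [Field F] {a b : F}
    (h : ∀ x : ℍ[F,a,b], x * star x = 0 → x = 0) (I : Submodule F ℍ[F,a,b])
    (hI : IsTernaryIdeal F tq I) : I = ⊥ ∨ I = ⊤ := by
  refine or_iff_not_imp_left.2 fun hbot => ?_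
  obtain ⟨x, hxI, hx⟩ := I.exists_mem_ne_zero_of_ne_bot hbot
  obtain ⟨r, hr⟩ : ∃ r : F, star x * x = algebraMap F ℍ[F,a,b] r :=
    ⟨_, QuaternionAlgebra.star_mul_eq_coe x⟩
  have hr0 : r ≠ 0 := by
    rintro rfl
    refine hx (star_eq_zero.1 (h (star x) ?_))
    rw [star_star, hr, map_zero]
  refine Submodule.eq_top_iff'.2 fun y => ?_
  have hmem : r • y ∈ I := by
    have := hI.2.2 y x x hxI
    rwa [tq, mul_assoc, hr, ← Algebra.commutes, ← Algebra.smul_def] at this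
  exact (I.smul_mem_iff hr0).1 hmem

open Quaternion in
/-- In the ternary algebra `𝒟₂` on `ℍ(a,b)`, every operator
`D_{x,y} = [R_{(x₁,x₂)}, R_{(y₁,y₂)}]` is a derivation (`𝒟₂` is a ternary
`D_{x,y}`-derivation algebra); moreover, if the norm form of `ℍ(a,b)` is
anisotropic then `𝒟₂` is simple. -/
theorem D2_derivation_and_simple (F : Type*) [Field F] [CharZero F]
    (a b : F) (ha : a ≠ 0) (hb : b ≠ 0) :
    (∀ x₁ x₂ y₁ y₂ : ℍ[F,a,b], IsTernaryDer tq (Dop tq x₁ x₂ y₁ y₂)) ∧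
    ((∀ x : ℍ[F,a,b], x * star x = 0 → x = 0) →
      IsTernarySimple F (tq (F := F) (a := a) (b := b))) := by
  refine ⟨fun x₁ x₂ y₁ y₂ => ?_, fun h => ⟨⟨1, 1, 1, by simp [tq]⟩, ternaryIdeal_eq_bot_or_top h⟩⟩
  rw [show Dop tq x₁ x₂ y₁ y₂ = _ from funext (Dop_tq x₁ x₂ y₁ y₂)]
  exact isTernaryDer_mul_right_of_star_eq_neg (star_commutator _ _)
end

section
/- A linear endomorphism D of ℍ(a,b) is a derivation of the ternary algebra 𝒟₂ if and only if D = Φ + Ψ for some Φ, Ψ ∈ End(ℍ(a,b)) where Φ is a derivation of the binary algebra ℍ(a,b) (Φ(xy) = Φ(x)y + xΦ(y) for all x,y) and Ψ is right multiplication by a skew element: Ψ(x) = x·Ψ(1) for all x with conjugate(Ψ(1)) = −Ψ(1). -/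
open Quaternion in
/-- A derivation of `ℍ(a,b)` takes values in the pure quaternions. -/
theorem QuaternionAlgebra.re_derivation_apply_eq_zero {F : Type*} [Field F] [CharZero F]
    {a b : F} (Φ : ℍ[F,a,b] →ₗ[F] ℍ[F,a,b])
    (hΦ : ∀ x y : ℍ[F,a,b], Φ (x * y) = Φ x * y + x * Φ y) (x : ℍ[F,a,b]) :
    (Φ x).re = 0 := by
  have h_one : Φ 1 = 0 := by simpa using hΦ 1 1
  have h_coe (r : F) : Φ (r : ℍ[F,a,b]) = 0 := by
    rw [show (r : ℍ[F,a,b]) = r • 1 by ext <;> simp, map_smul, h_one, smul_zero]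
  have h_im : Φ x = Φ x.im := by
    conv_lhs => rw [show x = (x.re : ℍ[F,a,b]) + x.im by ext <;> simp]
    rw [map_add, h_coe, zero_add]
  have h_sq : x.im * x.im = ((x.im * x.im).re : ℍ[F,a,b]) := by
    ext <;> simp <;> ring
  have h_anti : Φ x * x.im + x.im * Φ x = 0 := by
    rw [h_im, ← hΦ, h_sq, h_coe]
  by_contra hre
  have h2 : (2 : F) * (Φ x).re ≠ 0 := mul_ne_zero two_ne_zero hre
  have hI : x.imI = 0 := by
    have := congrArg QuaternionAlgebra.imI h_anti
    simp at this
    exact (mul_eq_zero.mp (by linear_combination this)).resolve_left h2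
  have hJ : x.imJ = 0 := by
    have := congrArg QuaternionAlgebra.imJ h_anti
    simp at this
    exact (mul_eq_zero.mp (by linear_combination this)).resolve_left h2
  have hK : x.imK = 0 := by
    have := congrArg QuaternionAlgebra.imK h_anti
    simp at this
    exact (mul_eq_zero.mp (by linear_combination this)).resolve_left h2
  refine hre ?_
  rw [h_im, show x.im = 0 by ext <;> simp [hI, hJ, hK], map_zero, QuaternionAlgebra.re_zero]

open Quaternion in
/-- A derivation of `ℍ(a,b)` commutes with the conjugation. -/
theorem QuaternionAlgebra.derivation_apply_star {F : Type*} [Field F] [CharZero F]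
    {a b : F} (Φ : ℍ[F,a,b] →ₗ[F] ℍ[F,a,b])
    (hΦ : ∀ x y : ℍ[F,a,b], Φ (x * y) = Φ x * y + x * Φ y) (x : ℍ[F,a,b]) :
    Φ (star x) = star (Φ x) := by
  have h_one : Φ 1 = 0 := by simpa using hΦ 1 1
  rw [QuaternionAlgebra.star_eq_neg.mpr
      (QuaternionAlgebra.re_derivation_apply_eq_zero Φ hΦ x),
    show star x = (2 * x.re) • (1 : ℍ[F,a,b]) - x by ext <;> simp; ring,
    map_sub, map_smul, h_one, smul_zero, zero_sub]

open Quaternion in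
/-- A linear endomorphism `D` of `ℍ(a,b)` is a derivation of the ternary
algebra `𝒟₂` iff `D = Φ + Ψ` where `Φ` is a derivation of the (binary) algebra
`ℍ(a,b)` and `Ψ` is right multiplication by a skew element:
`Ψ(x) = x·Ψ(1)` with `conj (Ψ 1) = −Ψ 1`. -/
theorem D2_der_characterization (F : Type*) [Field F] [CharZero F]
    (a b : F) (ha : a ≠ 0) (hb : b ≠ 0) :
    ∀ D : ℍ[F,a,b] →ₗ[F] ℍ[F,a,b],
      IsTernaryDer tq ⇑D ↔
        ∃ Φ Ψ : ℍ[F,a,b] →ₗ[F] ℍ[F,a,b],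
          D = Φ + Ψ ∧
          (∀ x y : ℍ[F,a,b], Φ (x * y) = Φ x * y + x * Φ y) ∧
          (∀ x : ℍ[F,a,b], Ψ x = x * Ψ 1) ∧
          star (Ψ 1) = -(Ψ 1) := by
  intro D
  constructor
  · intro hD
    have h_skew : star (D 1) = -D 1 := by
      have h := hD 1 1 1
      simp only [tq, star_one, mul_one, one_mul] at h
      rw [eq_neg_iff_add_eq_zero, ← add_left_cancel_iff (a := D 1), add_zero]
      rw [add_assoc] at h
      exact h.symm
    have hR : LinearMap.mulRight F (D 1) 1 = D 1 := by simp
    refine ⟨D - LinearMap.mulRight F (D 1), LinearMap.mulRight F (D 1), by simp, ?_, ?_, ?_⟩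
    · intro x y
      have h := hD x 1 y
      simp only [tq, star_one, mul_one, h_skew] at h
      simp only [LinearMap.sub_apply, LinearMap.mulRight_apply, h]
      noncomm_ring
    · intro x
      rw [hR, LinearMap.mulRight_apply]
    · rw [hR, h_skew]
  · rintro ⟨Φ, Ψ, rfl, hΦ, hΨ, h_skew⟩ x y z
    simp only [tq, LinearMap.add_apply, star_add, hΦ,
      QuaternionAlgebra.derivation_apply_star Φ hΦ]
    rw [hΨ (x * star y * z), hΨ x, hΨ y, hΨ z, star_mul, h_skew]
    noncomm_ring
end

section
/- Let F be a field of characteristic 0, V = F⁴ with standard basis b₁,…,b₄, and a = b₁. The reduced algebra 𝔸_a, i.e. V with the commutative binary product x∘y := ⟦a,x,y⟧ = (x,y)a + (a,y)x + (a,x)y, is not a Jordan algebra: there exist x,y ∈ V for which the commutator [R_x, R_y] of the binary right multiplication operators (R_x(z) = z∘x) fails the Leibniz rule, i.e. there exist u,v ∈ V with [R_x,R_y](u∘v) ≠ ([R_x,R_y]u)∘v + u∘([R_x,R_y]v). -/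
/-- The reduced (binary) product `x∘y := ⟦a,x,y⟧` of `𝔸` for `n = 4` and
`a = b₁`: `x∘y = (x,y)b₁ + (b₁,y)x + (b₁,x)y`. -/
def bmul (F : Type*) [Field F] (x y : Fin 4 → F) : Fin 4 → F :=
  tpA F 4 (Pi.single 0 1) x y

/-- The commutator `[R_x, R_y]` of binary right multiplication operators of
the reduced algebra `𝔸_{b₁}`, applied to `z`. -/
def Dbin (F : Type*) [Field F] (x y z : Fin 4 → F) : Fin 4 → F :=
  bmul F (bmul F z x) y - bmul F (bmul F z y) x

/-- For `char F = 0`, the reduced algebra `𝔸_{b₁}` (with `n = 4`) is not a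
Jordan algebra: some commutator `[R_x,R_y]` of right multiplication operators
fails the Leibniz rule. -/
theorem reduced_tpA_not_jordan (F : Type*) [Field F] [CharZero F] :
    ∃ x y u v : Fin 4 → F,
      Dbin F x y (bmul F u v) ≠
        bmul F (Dbin F x y u) v + bmul F u (Dbin F x y v) := by
  refine ⟨Pi.single 0 1, Pi.single 1 1, Pi.single 2 1, Pi.single 2 1, fun h => ?_⟩
  have h₁ := congrFun h 1
  simp [Dbin, bmul, tpA, Pi.single_apply] at h₁
end
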